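/- arXiv:math/0610261 — 2 statements merged into one kernel-verified Lean document; each statement's English description precedes it below -/
import Mathlib

section
/- Suppose the ideal I ⊆ R is homogeneous for total degree, G acts monomially on I up to degree d, and the initial ideal in_≼(I) is generated by monomials of total degree at most d. Then for every g ∈ G one has g(in_≼(I)) = in_{≼_{g⁻¹}}(I), where g(in_≼(I)) is the ideal generated by the images under g of the monomials of in_≼(I). -/
open MvPolynomial

/-- The image of a monomial (exponent vector) under a permutation `g` of the variables:
`g` sends `x_i` to `x_{g i}`. -/
noncomputable def actMon {n : ℕ} (g : Equiv.Perm (Fin n)) (a : Fin n →₀ ℕ) : Fin n →₀ ℕ :=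
  Finsupp.mapDomain g a

/-- Total degree of an exponent vector. -/
def tdeg {n : ℕ} (a : Fin n →₀ ℕ) : ℕ := a.sum fun _ e => e

/-- `le` is a monomial order: a linear order on exponent vectors with `0` minimal,
compatible with addition. -/
def IsMonOrder {n : ℕ} (le : (Fin n →₀ ℕ) → (Fin n →₀ ℕ) → Prop) : Prop :=
  (∀ a b, le a b ∨ le b a) ∧ (∀ a b, le a b → le b a → a = b) ∧
    (∀ a b c, le a b → le b c → le a c) ∧ (∀ a, le 0 a) ∧
    (∀ a b c, le a b → le (a + c) (b + c))

/-- The initial ideal of `I` with respect to the monomial (pre)order `le`: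
the ideal generated by the leading monomials of the nonzero elements of `I`. -/
noncomputable def initIdeal {k : Type*} [Field k] {n : ℕ}
    (le : (Fin n →₀ ℕ) → (Fin n →₀ ℕ) → Prop) (I : Ideal (MvPolynomial (Fin n) k)) :
    Ideal (MvPolynomial (Fin n) k) :=
  Ideal.span { m | ∃ f ∈ I, f ≠ 0 ∧ ∃ a ∈ f.support,
    (∀ b ∈ f.support, le b a) ∧ m = monomial a (1 : k) }

/-- `G` acts monomially on `I` up to degree `d` (via `ρ : G →* Perm (Fin n)`):
for every `h ∈ I` of total degree at most `d` and every `g ∈ G` there is `h' ∈ I`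
with `mon h' = g (mon h)`. -/
def MonomialActionUpTo {k : Type*} [Field k] {n : ℕ} {G : Type*} [Group G]
    (ρ : G →* Equiv.Perm (Fin n)) (I : Ideal (MvPolynomial (Fin n) k)) (d : ℕ) : Prop :=
  ∀ g : G, ∀ h ∈ I, h.totalDegree ≤ d →
    ∃ h' ∈ I, h'.support = h.support.image (actMon (ρ g))

/-- The exponent vectors of the leading monomials of the elements of `I`. -/
def leadingExponents {k : Type*} [Field k] {n : ℕ}
    (le : (Fin n →₀ ℕ) → (Fin n →₀ ℕ) → Prop) (I : Ideal (MvPolynomial (Fin n) k)) :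
    Set (Fin n →₀ ℕ) :=
  {a | ∃ f ∈ I, a ∈ f.support ∧ ∀ b ∈ f.support, le b a}

section

variable {k : Type*} [Field k] {n : ℕ} {le : (Fin n →₀ ℕ) → (Fin n →₀ ℕ) → Prop}
  {I : Ideal (MvPolynomial (Fin n) k)}

theorem IsMonOrder.exists_greatest (hle : IsMonOrder le) {s : Finset (Fin n →₀ ℕ)}
    (hs : s.Nonempty) : ∃ a ∈ s, ∀ b ∈ s, le b a := by
  obtain ⟨htot, -, htrans, -, -⟩ := hle
  have hrefl (a) : le a a := (htot a a).elim id id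
  induction hs using Finset.Nonempty.cons_induction with
  | singleton a => exact ⟨a, by simp, by simpa using hrefl a⟩
  | cons a s ha hs ih =>
    obtain ⟨m, hm, hmax⟩ := ih
    rcases htot a m with h | h
    · refine ⟨m, by simp [hm], fun b hb => ?_⟩
      rcases Finset.mem_cons.1 hb with rfl | hb
      exacts [h, hmax b hb]
    · refine ⟨a, by simp, fun b hb => ?_⟩
      rcases Finset.mem_cons.1 hb with rfl | hb
      exacts [hrefl _, htrans _ _ _ (hmax b hb) h]

theorem initIdeal_eq_span (le : (Fin n →₀ ℕ) → (Fin n →₀ ℕ) → Prop)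
    (I : Ideal (MvPolynomial (Fin n) k)) :
    initIdeal le I = Ideal.span ((fun a => monomial a (1 : k)) '' leadingExponents le I) := by
  unfold initIdeal leadingExponents
  congr 1
  ext m
  constructor
  · rintro ⟨f, hf, -, a, ha, hmax, rfl⟩
    exact ⟨a, ⟨f, hf, ha, hmax⟩, rfl⟩
  · rintro ⟨a, ⟨f, hf, ha, hmax⟩, rfl⟩
    exact ⟨f, hf, by rintro rfl; simp at ha, a, ha, hmax, rfl⟩

theorem monomial_mem_initIdeal_iff (hle : IsMonOrder le) {a : Fin n →₀ ℕ} :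
    monomial a (1 : k) ∈ initIdeal le I ↔ a ∈ leadingExponents le I := by
  rw [initIdeal_eq_span]
  refine ⟨fun h => ?_, fun h => Ideal.subset_span ⟨a, h, rfl⟩⟩
  rw [mem_ideal_span_monomial_image] at h
  obtain ⟨s, ⟨f, hf, hs, hmax⟩, hsa⟩ := h a (by simp)
  refine ⟨f * monomial (a - s) 1, I.mul_mem_right _ hf, ?_, fun b hb => ?_⟩
  · have := coeff_mul_monomial s (a - s) (1 : k) f
    rw [add_tsub_cancel_of_le hsa] at this
    simpa [mem_support_iff, this] using hs
  · rw [mem_support_iff, coeff_mul_monomial'] at hb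
    have hb' : a - s ≤ b := by
      by_contra h
      simp [h] at hb
    have := hle.2.2.2.2 _ _ (a - s) (hmax (b - (a - s)) (by simpa [hb'] using hb))
    rwa [tsub_add_cancel_of_le hb', add_tsub_cancel_of_le hsa] at this

/-- The homogeneous part of degree `e` of an ideal. -/
noncomputable def homogeneousPart (I : Ideal (MvPolynomial (Fin n) k)) (e : ℕ) :
    Submodule k (MvPolynomial (Fin n) k) :=
  I.restrictScalars k ⊓ homogeneousSubmodule (Fin n) k e

theorem exists_homogeneous_of_mem_leadingExponents
    (hhom : ∀ f ∈ I, ∀ i : ℕ, homogeneousComponent i f ∈ I) {a : Fin n →₀ ℕ}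
    (ha : a ∈ leadingExponents le I) :
    ∃ f ∈ homogeneousPart I (tdeg a), a ∈ f.support ∧ ∀ b ∈ f.support, le b a := by
  obtain ⟨f, hf, ha, hmax⟩ := ha
  refine ⟨homogeneousComponent (tdeg a) f,
    ⟨hhom f hf _, homogeneousComponent_isHomogeneous _ _⟩, ?_, fun b hb => hmax b ?_⟩
  · rw [mem_support_iff, coeff_homogeneousComponent]
    rw [mem_support_iff] at ha
    rwa [if_pos]
    rfl
  · rw [mem_support_iff, coeff_homogeneousComponent] at hb
    rw [mem_support_iff]
    exact fun h => hb (by simp [h])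

theorem finite_leadingExponents_degree (le : (Fin n →₀ ℕ) → (Fin n →₀ ℕ) → Prop)
    (I : Ideal (MvPolynomial (Fin n) k)) (e : ℕ) :
    {a ∈ leadingExponents le I | tdeg a = e}.Finite :=
  (Finsupp.finite_of_degree_le e).subset fun _ ha => ha.2.le

/-- An element of the homogeneous part is determined by its coefficients at leading exponents. -/
theorem injective_coeff_leadingExponents (hle : IsMonOrder le) (e : ℕ) :
    Function.Injective (LinearMap.pi fun a : {a ∈ leadingExponents le I | tdeg a = e} =>
      lcoeff k a.1 ∘ₗ (homogeneousPart I e).subtype) := by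
  rw [← LinearMap.ker_eq_bot, LinearMap.ker_eq_bot']
  rintro ⟨f, hfI, hfe⟩ h
  by_contra hf
  have hf : f ≠ 0 := fun h => hf (by simp [h])
  obtain ⟨a, ha, hmax⟩ := hle.exists_greatest (support_nonempty.2 hf)
  have hdeg : tdeg a = e :=
    (DFunLike.congr_fun Finsupp.degree_eq_weight_one a).trans (hfe (mem_support_iff.1 ha))
  exact mem_support_iff.1 ha (congrFun h ⟨a, ⟨f, hfI, ha, hmax⟩, hdeg⟩)

theorem finite_homogeneousPart (hle : IsMonOrder le) (e : ℕ) :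
    Module.Finite k (homogeneousPart I e) :=
  have := (finite_leadingExponents_degree le I e).to_subtype
  Module.Finite.of_injective _ (injective_coeff_leadingExponents hle e)

theorem finrank_homogeneousPart_le (hle : IsMonOrder le) (e : ℕ) :
    Module.finrank k (homogeneousPart I e) ≤
      {a ∈ leadingExponents le I | tdeg a = e}.ncard := by
  have := (finite_leadingExponents_degree le I e).fintype
  have h := LinearMap.finrank_le_finrank_of_injective
    (injective_coeff_leadingExponents (I := I) hle e)
  rwa [Module.finrank_fintype_fun_eq_card, ← Nat.card_eq_fintype_card] at h

theorem ncard_leadingExponents_le (hle : IsMonOrder le)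
    (hhom : ∀ f ∈ I, ∀ i : ℕ, homogeneousComponent i f ∈ I) (e : ℕ) :
    {a ∈ leadingExponents le I | tdeg a = e}.ncard ≤
      Module.finrank k (homogeneousPart I e) := by
  have := (finite_leadingExponents_degree le I e).fintype
  have := finite_homogeneousPart (I := I) hle e
  have hex (a : {a ∈ leadingExponents le I | tdeg a = e}) :
      ∃ f : homogeneousPart I e, a.1 ∈ f.1.support ∧ ∀ b ∈ f.1.support, le b a.1 := by
    obtain ⟨a, ha, rfl⟩ := a
    obtain ⟨f, hf, h⟩ := exists_homogeneous_of_mem_leadingExponents hhom ha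
    exact ⟨⟨f, hf⟩, h⟩
  choose f hlead hmax using hex
  have hli : LinearIndependent k f := by
    rw [Fintype.linearIndependent_iff]
    intro c hc
    by_contra! hne
    obtain ⟨i, hi⟩ := hne
    classical
    obtain ⟨m, hm, hm_max⟩ := hle.exists_greatest
      (s := (Finset.univ.filter fun i => c i ≠ 0).image Subtype.val) ⟨i.1, by
        simp only [Finset.mem_image, Finset.mem_filter, Finset.mem_univ, true_and]
        exact ⟨i, hi, rfl⟩⟩
    obtain ⟨j, hj, rfl⟩ := Finset.mem_image.1 hm
    have hcj : c j ≠ 0 := (Finset.mem_filter.1 hj).2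
    have h0 := congrArg (fun p : homogeneousPart I e => coeff j.1 p.1) hc
    simp only [Submodule.coe_sum, Submodule.coe_smul, coeff_sum, coeff_smul,
      Submodule.coe_zero, coeff_zero, smul_eq_mul] at h0
    rw [Finset.sum_eq_single j] at h0
    · exact mul_ne_zero hcj (mem_support_iff.1 (hlead j)) h0
    · intro b _ hbj
      by_contra hb
      obtain ⟨hcb, hfb⟩ := mul_ne_zero_iff.1 hb
      refine hbj (Subtype.ext (hle.2.1 _ _ (hm_max b.1 ?_) ?_))
      · exact Finset.mem_image_of_mem _ (by simp [hcb])
      · exact hmax b j.1 (mem_support_iff.2 hfb)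
    · simp
  have h := hli.fintype_card_le_finrank
  rwa [← Nat.card_eq_fintype_card] at h

theorem actMon_injective (σ : Equiv.Perm (Fin n)) : Function.Injective (actMon σ) :=
  Finsupp.mapDomain_injective σ.injective

theorem actMon_add (σ : Equiv.Perm (Fin n)) (a b : Fin n →₀ ℕ) :
    actMon σ (a + b) = actMon σ a + actMon σ b :=
  Finsupp.mapDomain_add

theorem tdeg_actMon (σ : Equiv.Perm (Fin n)) (a : Fin n →₀ ℕ) : tdeg (actMon σ a) = tdeg a :=
  Finsupp.sum_mapDomain_index (fun _ => rfl) (fun _ _ _ => rfl)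

theorem actMon_inv_actMon {G : Type*} [Group G] (ρ : G →* Equiv.Perm (Fin n)) (g : G)
    (a : Fin n →₀ ℕ) : actMon (ρ g⁻¹) (actMon (ρ g) a) = a := by
  unfold actMon
  rw [← Finsupp.mapDomain_comp, ← Equiv.Perm.coe_mul, ← map_mul]
  simp

theorem IsMonOrder.comap_actMon (hle : IsMonOrder le) (σ : Equiv.Perm (Fin n)) :
    IsMonOrder fun a b => le (actMon σ a) (actMon σ b) := by
  obtain ⟨htot, hanti, htrans, hzero, hadd⟩ := hle
  refine ⟨fun _ _ => htot _ _, fun a b h h' => actMon_injective σ (hanti _ _ h h'),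
    fun _ _ _ => htrans _ _ _, fun a => ?_, fun a b c h => ?_⟩
  · simpa [actMon] using hzero (actMon σ a)
  · simpa only [actMon_add] using hadd _ _ _ h

theorem actMon_mem_leadingExponents {G : Type*} [Group G] {ρ : G →* Equiv.Perm (Fin n)}
    (hhom : ∀ f ∈ I, ∀ i : ℕ, homogeneousComponent i f ∈ I) {d : ℕ}
    (hmon : MonomialActionUpTo ρ I d) (g : G) {a : Fin n →₀ ℕ} (had : tdeg a ≤ d)
    (ha : a ∈ leadingExponents le I) :
    actMon (ρ g) a ∈
      leadingExponents (fun a b => le (actMon (ρ g⁻¹) a) (actMon (ρ g⁻¹) b)) I := by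
  obtain ⟨f, hf, ha, hmax⟩ := exists_homogeneous_of_mem_leadingExponents hhom ha
  obtain ⟨h, hh, hsupp⟩ := hmon g f hf.1 ((IsHomogeneous.totalDegree_le hf.2).trans had)
  refine ⟨h, hh, hsupp ▸ Finset.mem_image_of_mem _ ha, fun b hb => ?_⟩
  rw [hsupp] at hb
  obtain ⟨c, hc, rfl⟩ := Finset.mem_image.1 hb
  simpa only [actMon_inv_actMon] using hmax c hc

end

/-- If `I` is homogeneous for total degree, `G` acts monomially on `I` up to
degree `d`, and `in_≼(I)` is generated by monomials of total degree at most `d`, then for every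
`g ∈ G`, `g (in_≼(I)) = in_{≼_{g⁻¹}}(I)`. -/
theorem stmt0 {k : Type*} [Field k] {n : ℕ} {G : Type*} [Group G]
    (ρ : G →* Equiv.Perm (Fin n)) (I : Ideal (MvPolynomial (Fin n) k))
    (hhom : ∀ f ∈ I, ∀ i : ℕ, MvPolynomial.homogeneousComponent i f ∈ I)
    (le : (Fin n →₀ ℕ) → (Fin n →₀ ℕ) → Prop) (hle : IsMonOrder le)
    (d : ℕ) (hmon : MonomialActionUpTo ρ I d)
    (hgen : ∃ S : Set (Fin n →₀ ℕ), (∀ a ∈ S, tdeg a ≤ d) ∧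
      initIdeal le I =
        Ideal.span ((fun a => (monomial a (1 : k) : MvPolynomial (Fin n) k)) '' S))
    (g : G) :
    Ideal.map (rename (⇑(ρ g)) : MvPolynomial (Fin n) k →ₐ[k] MvPolynomial (Fin n) k)
        (initIdeal le I)
      = initIdeal (fun a b => le (actMon (ρ g⁻¹) a) (actMon (ρ g⁻¹) b)) I := by
  have hle' := hle.comap_actMon (ρ g⁻¹)
  have hrename (a : Fin n →₀ ℕ) :
      rename (ρ g) (monomial a (1 : k)) = monomial (actMon (ρ g) a) 1 :=
    rename_monomial _ _ _
  have hmap : Ideal.map (rename (⇑(ρ g)) : MvPolynomial (Fin n) k →ₐ[k] MvPolynomial (Fin n) k)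
      (initIdeal le I)
      ≤ initIdeal (fun a b => le (actMon (ρ g⁻¹) a) (actMon (ρ g⁻¹) b)) I := by
    obtain ⟨S, hS, hspan⟩ := hgen
    rw [hspan, Ideal.map_span, Ideal.span_le]
    rintro _ ⟨_, ⟨a, ha, rfl⟩, rfl⟩
    simp only [hrename, SetLike.mem_coe]
    refine (monomial_mem_initIdeal_iff hle').2
      (actMon_mem_leadingExponents hhom hmon g (hS a ha) ?_)
    rw [← monomial_mem_initIdeal_iff hle, hspan]
    exact Ideal.subset_span ⟨a, ha, rfl⟩
  refine le_antisymm hmap ?_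
  rw [initIdeal_eq_span, Ideal.span_le]
  rintro _ ⟨a, ha, rfl⟩
  have hsub : actMon (ρ g) '' {b ∈ leadingExponents le I | tdeg b = tdeg a} ⊆
      {b ∈ leadingExponents (fun a b => le (actMon (ρ g⁻¹) a) (actMon (ρ g⁻¹) b)) I |
        tdeg b = tdeg a} := by
    rintro _ ⟨b, ⟨hb, hdeg⟩, rfl⟩
    refine ⟨(monomial_mem_initIdeal_iff hle').1 (hmap ?_), (tdeg_actMon _ _).trans hdeg⟩
    rw [← hrename]
    exact Ideal.mem_map_of_mem _ ((monomial_mem_initIdeal_iff hle).2 hb)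
  have heq := Set.eq_of_subset_of_ncard_le hsub
    (by
      rw [Set.ncard_image_of_injective _ (actMon_injective _)]
      exact (ncard_leadingExponents_le hle' hhom _).trans (finrank_homogeneousPart_le hle _))
    (finite_leadingExponents_degree _ I _)
  obtain ⟨b, ⟨hb, -⟩, rfl⟩ := heq.ge ⟨ha, rfl⟩
  simp only [← hrename, SetLike.mem_coe]
  exact Ideal.mem_map_of_mem _ ((monomial_mem_initIdeal_iff hle).2 hb)
end

section
/- Let M ⊆ R be a monomial ideal and m ∈ ℕ. Suppose there exist c ∈ ℕ and N ∈ ℕ such that either dim_k (R/M)_{mℓ + a_1ε_1 + … + a_6ε_6} = c for all a_1,…,a_6 ≥ N, or dim_k (R/(M : u^∞))_{mℓ + a_1ε_1 + … + a_6ε_6} = c for all a_1,…,a_6 ≥ N. Then there is N' ∈ ℕ such that for all a_1,…,a_6 ≥ N', dim_k (R/M)_{mℓ + a_1ε_1 + … + a_6ε_6} = dim_k (R/(M : u^∞))_{mℓ + a_1ε_1 + … + a_6ε_6}. -/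
open MvPolynomial

/-- The Picard lattice `ℤ^7` of a degree-3 Del Pezzo surface, with basis `ℓ, ε_1, …, ε_6`
(coordinate `0` is the `ℓ`-coordinate). -/
abbrev Pic7 := Fin 7 → ℤ

/-- The intersection form: `⟨ℓ,ℓ⟩ = 1`, `⟨ε_i,ε_j⟩ = -δ_ij`, `⟨ℓ,ε_i⟩ = 0`. -/
def ip (u v : Pic7) : ℤ := u 0 * v 0 - ∑ i : Fin 6, u i.succ * v i.succ

/-- The class `ℓ`. -/
def lv : Pic7 := fun j => if j = 0 then 1 else 0

/-- The class `ε_i`. -/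
def ev (i : Fin 6) : Pic7 := fun j => if j = i.succ then 1 else 0

/-- The canonical class `K = -3ℓ + ε_1 + … + ε_6`. -/
def Kcl : Pic7 := fun j => if j = 0 then -3 else 1

/-- An exceptional class: `⟨v,v⟩ = -1` and `⟨K,v⟩ = -1`. -/
def IsExc (v : Pic7) : Prop := ip v v = -1 ∧ ip Kcl v = -1

/-- A conic class: `⟨v,v⟩ = 0` and `⟨K,v⟩ = -2`. -/
def IsConic (v : Pic7) : Prop := ip v v = 0 ∧ ip Kcl v = -2

lemma excEv (i : Fin 6) : IsExc (ev i) := by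
  have h0 : ((0 : Fin 7) = i.succ) = False := by
    simp [eq_comm, Fin.succ_ne_zero]
  constructor <;>
    simp [IsExc, ip, ev, Kcl, h0, Fin.succ_inj, Fin.succ_ne_zero, ite_mul, mul_ite,
      Finset.sum_ite_eq, eq_comm]

/-- The type of exceptional classes (one polynomial variable for each of them). -/
def Exc : Type := { v : Pic7 // IsExc v }

/-- The `ℤ^7`-degree of a monomial in the variables `x_c`, `c` exceptional, where
`deg x_c = c`. -/
def mdegE (a : Exc →₀ ℕ) : Pic7 := a.sum fun c e => e • c.1

/-- The `k`-span of the monomials of degree `D`. -/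
noncomputable def degSubE (k : Type*) [Field k] (D : Pic7) : Submodule k (MvPolynomial Exc k) :=
  Submodule.span k
    ((fun a => (monomial a (1 : k) : MvPolynomial Exc k)) '' { a | mdegE a = D })

/-- The degree-`D` piece `(R/M)_D`: the image in `R/M` of the span of the monomials of
degree `D`. -/
noncomputable def quotPieceE {k : Type*} [Field k] (M : Ideal (MvPolynomial Exc k)) (D : Pic7) :
    Submodule k (MvPolynomial Exc k ⧸ Submodule.restrictScalars k M) :=
  Submodule.map (Submodule.restrictScalars k M).mkQ (degSubE k D)

/-- The product `u = x_{ε_1} ⋯ x_{ε_6}` of the variables corresponding to the classes of the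
exceptional divisors. -/
noncomputable def uProd (k : Type*) [Field k] : MvPolynomial Exc k :=
  ∏ i : Fin 6, X (⟨ev i, excEv i⟩ : Exc)

/-- The saturation `(M : u^∞) = ⋃_j (M : u^j)`. -/
noncomputable def satIdeal {k : Type*} [Field k] (M : Ideal (MvPolynomial Exc k))
    (u : MvPolynomial Exc k) : Ideal (MvPolynomial Exc k) :=
  ⨆ j : ℕ, Submodule.colon M (Ideal.span {u ^ j})

/-- The degree `mℓ + a_1ε_1 + … + a_6ε_6`. -/
def DvE (m : ℕ) (a : Fin 6 → ℕ) : Pic7 := (m : ℤ) • lv + ∑ i : Fin 6, (a i : ℤ) • ev i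

/-- The Cauchy–Schwarz bound on the `ℓ`-coordinate of an exceptional class, together with the
two defining equations in coordinates. -/
lemma IsExc.coords {v : Pic7} (hv : IsExc v) :
    (0 ≤ v 0 ∧ v 0 ≤ 2) ∧ ∑ i : Fin 6, v i.succ ^ 2 = v 0 ^ 2 + 1 ∧
      ∑ i : Fin 6, v i.succ = 1 - 3 * v 0 := by
  obtain ⟨h1, h2⟩ := hv
  have hsq : ∑ i : Fin 6, v i.succ ^ 2 = v 0 ^ 2 + 1 := by
    simp only [ip, ← pow_two] at h1
    linarith
  have hsum : ∑ i : Fin 6, v i.succ = 1 - 3 * v 0 := by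
    simp only [ip, Kcl, Fin.succ_ne_zero, if_true, if_false, one_mul] at h2
    linarith
  have hcs := sq_sum_le_card_mul_sum_sq (s := Finset.univ) (f := fun i : Fin 6 => v i.succ)
  rw [hsq, hsum] at hcs
  norm_num at hcs
  exact ⟨⟨by nlinarith, by nlinarith⟩, hsq, hsum⟩

instance Exc.finite : Finite Exc := by
  refine Set.Finite.subset (Set.finite_Icc (fun _ => -5 : Pic7) (fun _ => 5)) fun v hv => ?_
  obtain ⟨⟨h0, h2⟩, hsq, -⟩ := IsExc.coords hv
  have key : ∀ j, -5 ≤ v j ∧ v j ≤ 5 := by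
    intro j
    refine Fin.cases ⟨by linarith, by linarith⟩ (fun i => ?_) j
    have hi := Finset.single_le_sum (f := fun i : Fin 6 => v i.succ ^ 2)
      (fun i _ => sq_nonneg _) (Finset.mem_univ i)
    simp only [hsq] at hi
    constructor <;> nlinarith
  exact ⟨fun j => (key j).1, fun j => (key j).2⟩

/-- The only exceptional class with a positive `ε_i`-coordinate is `ε_i`. -/
lemma IsExc.eq_ev_of_pos {v : Pic7} (hv : IsExc v) {i : Fin 6} (hi : 0 < v i.succ) :
    v = ev i := by
  obtain ⟨⟨h0, h2⟩, hsq, hsum⟩ := hv.coords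
  have hnn : ∀ x : ℤ, 0 ≤ x ^ 2 + x := fun x => by
    rcases le_or_gt 0 x with h | h <;> nlinarith
  have htot : ∑ j : Fin 6, (v j.succ ^ 2 + v j.succ) = (v 0 - 1) * (v 0 - 2) := by
    rw [Finset.sum_add_distrib, hsq, hsum]
    ring
  have hle := Finset.single_le_sum (f := fun j : Fin 6 => v j.succ ^ 2 + v j.succ)
    (fun j _ => hnn _) (Finset.mem_univ i)
  simp only [htot] at hle
  have hv0 : v 0 = 0 := by
    have : v 0 = 0 ∨ v 0 = 1 ∨ v 0 = 2 := by omega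
    rcases this with h | h | h
    · exact h
    all_goals
      rw [h] at hle
      nlinarith
  rw [hv0] at hsq
  have hsplit := Finset.add_sum_erase Finset.univ (fun j : Fin 6 => v j.succ ^ 2)
    (Finset.mem_univ i)
  simp only [hsq] at hsplit
  have hrest : ∀ j, j ≠ i → v j.succ = 0 := by
    intro j hj
    have := Finset.single_le_sum (f := fun j : Fin 6 => v j.succ ^ 2) (s := Finset.univ.erase i)
      (fun j _ => sq_nonneg _) (Finset.mem_erase.2 ⟨hj, Finset.mem_univ j⟩)
    exact pow_eq_zero_iff two_ne_zero |>.1 (le_antisymm (by nlinarith) (sq_nonneg _))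
  have hvi : v i.succ = 1 := by
    have := Finset.sum_nonneg (s := Finset.univ.erase i)
      (f := fun j : Fin 6 => v j.succ ^ 2) (fun j _ => sq_nonneg _)
    nlinarith
  funext j
  refine Fin.cases ?_ (fun j => ?_) j
  · simp [ev, hv0, (Fin.succ_ne_zero i).symm]
  · by_cases hj : j = i
    · simp [ev, hj, hvi]
    · simp [ev, hj, hrest j hj]

/-- The class `ε_i` as an element of the index type of the variables. -/
def excE (i : Fin 6) : Exc := ⟨ev i, excEv i⟩

/-- The `ε_i`-coordinate of the degree of a monomial is at most its exponent in `x_{ε_i}`. -/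
lemma mdegE_succ_le (s : Exc →₀ ℕ) (i : Fin 6) :
    mdegE s i.succ ≤ s (excE i) := by
  classical
  have happ : mdegE s i.succ = ∑ c ∈ s.support, (s c : ℤ) * c.1 i.succ := by
    simp [mdegE, Finsupp.sum, Finset.sum_apply]
  have hterm : ∀ c ∈ s.support, (s c : ℤ) * c.1 i.succ ≤
      if c = (excE i) then (s (excE i) : ℤ) else 0 := by
    intro c _
    split_ifs with h
    · subst h
      simp [excE, ev]
    · have : c.1 i.succ ≤ 0 := by
        by_contra! hpos
        exact h (Subtype.ext (IsExc.eq_ev_of_pos c.2 hpos))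
      exact mul_nonpos_of_nonneg_of_nonpos (Int.natCast_nonneg _) this
  rw [happ]
  refine (Finset.sum_le_sum hterm).trans ?_
  rw [Finset.sum_ite_eq']
  split_ifs
  · exact le_rfl
  · exact Int.natCast_nonneg _

lemma DvE_succ (m : ℕ) (a : Fin 6 → ℕ) (i : Fin 6) : DvE m a i.succ = a i := by
  simp [DvE, lv, ev, Finset.sum_apply]

/-- Every polynomial in the degree-`D` piece is supported on monomials of degree `D`. -/
lemma mdegE_of_mem_support {k : Type*} [Field k] {D : Pic7} {f : MvPolynomial Exc k}
    (hf : f ∈ degSubE k D) {s : Exc →₀ ℕ} (hs : s ∈ f.support) : mdegE s = D := by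
  classical
  induction hf using Submodule.span_induction generalizing s with
  | mem x hx =>
    obtain ⟨a, ha, rfl⟩ := hx
    have := support_monomial_subset hs
    rw [Finset.mem_singleton] at this
    exact this ▸ ha
  | zero => simp at hs
  | add x y _ _ hx hy =>
    rcases Finset.mem_union.1 (support_add hs) with h | h
    · exact hx h
    · exact hy h
  | smul r x _ hx => exact hx (support_smul hs)

/-- Dickson's lemma: a set of exponents in finitely many variables contains a finite subset
that lies below every element. -/
lemma exists_finite_subset_forall_exists_le {σ : Type*} [Finite σ] (S : Set (σ →₀ ℕ)) :
    ∃ T ⊆ S, T.Finite ∧ ∀ s ∈ S, ∃ t ∈ T, t ≤ s := by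
  refine ⟨{t | Minimal (· ∈ S) t}, fun t ht => ht.prop, ?_, fun s hs => ?_⟩
  · exact WellQuasiOrderedLE.finite_of_isAntichain (setOfPred_minimal_antichain (· ∈ S))
  · obtain ⟨t, hts, ht⟩ := exists_minimal_le_of_wellFoundedLT (· ∈ S) s hs
    exact ⟨t, ht, hts⟩

/-- The exponent of `u = x_{ε_1} ⋯ x_{ε_6}`. -/
noncomputable def uExp : Exc →₀ ℕ :=
  ∑ i : Fin 6, Finsupp.single (excE i) 1

lemma uProd_pow (k : Type*) [Field k] (j : ℕ) : uProd k ^ j = monomial (j • uExp) 1 := by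
  have : uProd k = monomial uExp 1 := by
    rw [uExp, monomial_sum_one]
    rfl
  rw [this, monomial_pow, one_pow]

lemma uExp_apply_of_ne {c : Exc} (hc : ∀ i, c ≠ (excE i)) : uExp c = 0 := by
  classical
  rw [uExp, Finsupp.finsetSum_apply]
  exact Finset.sum_eq_zero fun i _ => Finsupp.single_eq_of_ne (hc i)

/-- An element of the saturation is multiplied into the ideal by some power of `u`. -/
lemma mem_satIdeal {k : Type*} [Field k] {M : Ideal (MvPolynomial Exc k)}
    {u f : MvPolynomial Exc k} : f ∈ satIdeal M u ↔ ∃ j : ℕ, f * u ^ j ∈ M := by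
  have hmem : ∀ j, f ∈ Submodule.colon M (Ideal.span {u ^ j} : Set (MvPolynomial Exc k)) ↔
      f * u ^ j ∈ M := fun j => by
    rw [Ideal.span, Submodule.colon_span, Submodule.mem_colon_singleton, smul_eq_mul]
  have hmono : Monotone fun j : ℕ =>
      Submodule.colon M (Ideal.span {u ^ j} : Set (MvPolynomial Exc k)) := by
    intro i j hij
    refine Submodule.colon_mono le_rfl ?_
    exact Ideal.span_singleton_le_span_singleton.2 (pow_dvd_pow u hij)
  rw [satIdeal, Submodule.mem_iSup_of_directed _ hmono.directed_le]
  exact exists_congr hmem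

/-- Degree pieces of two quotients have the same dimension if the ideals agree in that degree. -/
lemma finrank_quotPieceE_congr {k : Type*} [Field k] {I J : Ideal (MvPolynomial Exc k)}
    {D : Pic7} (h : ∀ f ∈ degSubE k D, f ∈ I ↔ f ∈ J) :
    Module.finrank k (quotPieceE I D) = Module.finrank k (quotPieceE J D) := by
  have hrange : ∀ L : Ideal (MvPolynomial Exc k), quotPieceE L D =
      LinearMap.range ((Submodule.restrictScalars k L).mkQ.domRestrict (degSubE k D)) :=
    fun L => (LinearMap.range_domRestrict _ _).symm
  have hker : LinearMap.ker ((Submodule.restrictScalars k I).mkQ.domRestrict (degSubE k D)) =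
      LinearMap.ker ((Submodule.restrictScalars k J).mkQ.domRestrict (degSubE k D)) := by
    ext f
    simpa using h f f.2
  rw [hrange, hrange]
  exact LinearEquiv.finrank_eq <| (LinearMap.quotKerEquivRange _).symm.trans <|
    (Submodule.quotEquivOfEq _ _ hker).trans (LinearMap.quotKerEquivRange _)

/-- If for some `c` and all `a_i ≫ 0` either `dim (R/M)_{mℓ+Σa_iε_i} = c` or
`dim (R/(M:u^∞))_{mℓ+Σa_iε_i} = c`, then for all `a_i ≫ 0` the two dimensions agree. -/
theorem stmt7 {k : Type*} [Field k] (M : Ideal (MvPolynomial Exc k))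
    (hM : ∃ S : Set (Exc →₀ ℕ),
      M = Ideal.span ((fun a => (monomial a (1 : k) : MvPolynomial Exc k)) '' S))
    (m : ℕ)
    (hyp : ∃ (c N : ℕ),
      (∀ a : Fin 6 → ℕ, (∀ i, N ≤ a i) →
          Module.finrank k (quotPieceE M (DvE m a)) = c) ∨
      (∀ a : Fin 6 → ℕ, (∀ i, N ≤ a i) →
          Module.finrank k (quotPieceE (satIdeal M (uProd k)) (DvE m a)) = c)) :
    ∃ N' : ℕ, ∀ a : Fin 6 → ℕ, (∀ i, N' ≤ a i) →
      Module.finrank k (quotPieceE M (DvE m a)) =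
        Module.finrank k (quotPieceE (satIdeal M (uProd k)) (DvE m a)) := by
  obtain ⟨S, rfl⟩ := hM
  obtain ⟨T, hTS, hT, hle⟩ := exists_finite_subset_forall_exists_le S
  obtain ⟨B, hB⟩ := hT.bddAbove
  refine ⟨∑ i : Fin 6, B (excE i), fun a ha =>
    finrank_quotPieceE_congr fun f hf => ⟨fun h => mem_satIdeal.2 ⟨0, by simpa using h⟩, ?_⟩⟩
  intro h
  obtain ⟨j, hj⟩ := mem_satIdeal.1 h
  rw [uProd_pow, mem_ideal_span_monomial_image] at hj
  rw [mem_ideal_span_monomial_image]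
  intro s hs
  obtain ⟨t₀, ht₀, hts₀⟩ := hj (s + j • uExp) (by
    rw [mem_support_iff, coeff_mul_monomial, mul_one]
    exact mem_support_iff.1 hs)
  obtain ⟨t, ht, htt₀⟩ := hle t₀ ht₀
  refine ⟨t, hTS ht, fun c => ?_⟩
  by_cases hc : ∃ i, c = (excE i)
  · obtain ⟨i, rfl⟩ := hc
    have hsa := mdegE_succ_le s i
    rw [mdegE_of_mem_support hf hs, DvE_succ] at hsa
    have hBi := Finset.single_le_sum (f := fun i : Fin 6 => B (excE i))
      (fun _ _ => Nat.zero_le _) (Finset.mem_univ i)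
    exact (hB ht _).trans (hBi.trans ((ha i).trans (by exact_mod_cast hsa)))
  · push Not at hc
    have := (htt₀.trans hts₀) c
    simpa [uExp_apply_of_ne hc] using this
end
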